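/- Let B be a (K₂, F₂, Z₂, S₂) PDA with integer entries in [S₂], let F₁ be a positive integer, and let c₁, …, c_{F₁} be pairwise distinct natural numbers. Define the (F₁F₂)×K₂ array P, with rows indexed by pairs (i, f₂) ∈ [F₁]×[F₂], by P((i,f₂), k₂) = * if B(f₂,k₂) = *, and P((i,f₂), k₂) = B(f₂,k₂) + cᵢ·S₂ otherwise. Then P satisfies conditions C1 (each column has exactly F₁·Z₂ stars) and C3, and its set of integer entries is the disjoint union over i ∈ [F₁] of the sets [S₂] + cᵢS₂, of cardinality F₁·S₂; hence P is a (K₂, F₁F₂, F₁Z₂, F₁S₂) PDA with this integer alphabet. -/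

import Mathlib

/-- A `(K, |ρ|, Z, |S|)` placement delivery array with rows indexed by the finite type `ρ`
and integer alphabet the finite set `S ⊆ ℕ` (a star is modeled by `none`), satisfying
conditions C1, C2, C3. -/
def IsPDA {ρ : Type} [Fintype ρ] [DecidableEq ρ] (K : ℕ) (S : Finset ℕ) (Z : ℕ)
    (P : ρ → Fin K → Option ℕ) : Prop :=
  (∀ (j : ρ) (k : Fin K) (s : ℕ), P j k = some s → s ∈ S) ∧
  (∀ k : Fin K, (Finset.univ.filter fun j : ρ => P j k = none).card = Z) ∧
  (∀ s ∈ S, ∃ (j : ρ) (k : Fin K), P j k = some s) ∧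
  (∀ (j₁ j₂ : ρ) (k₁ k₂ : Fin K) (s : ℕ),
    P j₁ k₁ = some s → P j₂ k₂ = some s → (j₁, k₁) ≠ (j₂, k₂) →
    j₁ ≠ j₂ ∧ k₁ ≠ k₂ ∧ P j₁ k₂ = none ∧ P j₂ k₁ = none)

/-- Shifts of `[S]` by distinct multiples of `S` do not overlap. -/
theorem eq_and_eq_of_add_mul_eq {S b b' x y : ℕ} (hb : b ∈ Finset.Icc 1 S)
    (hb' : b' ∈ Finset.Icc 1 S) (h : b + x * S = b' + y * S) : b = b' ∧ x = y := by
  rw [Finset.mem_Icc] at hb hb'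
  have hxy : x = y := by
    rcases lt_trichotomy x y with hlt | heq | hlt
    · have := Nat.mul_le_mul_right S (Nat.succ_le_of_lt hlt)
      rw [Nat.succ_mul] at this
      omega
    · exact heq
    · have := Nat.mul_le_mul_right S (Nat.succ_le_of_lt hlt)
      rw [Nat.succ_mul] at this
      omega
  subst hxy
  exact ⟨by omega, rfl⟩

/-- Let `B` be a `(K₂,F₂,Z₂,S₂)` PDA with entries in `[S₂]`, let `F₁ > 0`,
and let `c₁, …, c_{F₁}` be pairwise distinct naturals. The `(F₁F₂) × K₂` array `P` defined on
rows `(i,f₂)` by `P((i,f₂),k₂) = B(f₂,k₂) + cᵢ·S₂` (stars staying stars) satisfies C1 with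
`F₁·Z₂` stars per column and C3, and its integer alphabet is the disjoint union over
`i ∈ [F₁]` of the sets `[S₂] + cᵢS₂`, of cardinality `F₁·S₂`; hence `P` is a
`(K₂, F₁F₂, F₁Z₂, F₁S₂)` PDA with this alphabet. -/
theorem stacked_shifted_pda (K₂ F₂ Z₂ S₂ F₁ : ℕ)
    (hK₂ : 0 < K₂) (hF₂ : 0 < F₂) (hZ₂ : 0 < Z₂) (hS₂ : 0 < S₂) (hF₁ : 0 < F₁)
    (B : Fin F₂ → Fin K₂ → Option ℕ) (hB : IsPDA K₂ (Finset.Icc 1 S₂) Z₂ B)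
    (c : Fin F₁ → ℕ) (hc : Function.Injective c)
    (P : Fin F₁ × Fin F₂ → Fin K₂ → Option ℕ)
    (hP : ∀ (p : Fin F₁ × Fin F₂) (k₂ : Fin K₂),
      P p k₂ = (B p.2 k₂).map fun b => b + c p.1 * S₂)
    (A : Finset ℕ)
    (hA : A = Finset.univ.biUnion fun i : Fin F₁ =>
      (Finset.Icc 1 S₂).image fun b => b + c i * S₂) :
    IsPDA K₂ A (F₁ * Z₂) P ∧
    (∀ i i' : Fin F₁, i ≠ i' →
      Disjoint ((Finset.Icc 1 S₂).image fun b => b + c i * S₂)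
        ((Finset.Icc 1 S₂).image fun b => b + c i' * S₂)) ∧
    A.card = F₁ * S₂ := by
  obtain ⟨hmem, hstar, hocc, hdiag⟩ := hB
  have hdisj : ∀ i i' : Fin F₁, i ≠ i' →
      Disjoint ((Finset.Icc 1 S₂).image fun b => b + c i * S₂)
        ((Finset.Icc 1 S₂).image fun b => b + c i' * S₂) := by
    intro i i' hne
    rw [Finset.disjoint_left]
    intro s hs hs'
    obtain ⟨b, hb, rfl⟩ := Finset.mem_image.1 hs
    obtain ⟨b', hb', h⟩ := Finset.mem_image.1 hs'
    exact hne (hc (eq_and_eq_of_add_mul_eq hb' hb h).2.symm)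
  refine ⟨⟨?_, ?_, ?_, ?_⟩, hdisj, ?_⟩
  · intro j k s hs
    rw [hP, Option.map_eq_some_iff] at hs
    obtain ⟨b, hb, rfl⟩ := hs
    rw [hA]
    exact Finset.mem_biUnion.2
      ⟨j.1, Finset.mem_univ _, Finset.mem_image_of_mem _ (hmem _ _ _ hb)⟩
  · intro k
    have hfilter : (Finset.univ.filter fun j : Fin F₁ × Fin F₂ => P j k = none) =
        Finset.univ ×ˢ Finset.univ.filter fun f : Fin F₂ => B f k = none := by
      ext j
      simp [hP]
    rw [hfilter, Finset.card_product, hstar, Finset.card_univ, Fintype.card_fin]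
  · intro s hs
    rw [hA] at hs
    obtain ⟨i, -, hs⟩ := Finset.mem_biUnion.1 hs
    obtain ⟨b, hb, rfl⟩ := Finset.mem_image.1 hs
    obtain ⟨f, k, hfk⟩ := hocc b hb
    exact ⟨(i, f), k, by simp [hP, hfk]⟩
  · rintro ⟨i₁, f₁⟩ ⟨i₂, f₂⟩ k₁ k₂ s h₁ h₂ hne
    rw [hP, Option.map_eq_some_iff] at h₁ h₂
    obtain ⟨b₁, hb₁, rfl⟩ := h₁
    obtain ⟨b₂, hb₂, h⟩ := h₂
    obtain ⟨rfl, hci⟩ := eq_and_eq_of_add_mul_eq (hmem _ _ _ hb₂) (hmem _ _ _ hb₁) h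
    obtain rfl := hc hci
    obtain ⟨hf, hk, hn₁, hn₂⟩ := hdiag f₁ f₂ k₁ k₂ b₂ hb₁ hb₂ (by
      rintro ⟨⟩
      exact hne rfl)
    exact ⟨fun h => hf (Prod.mk.inj h).2, hk, by simp [hP, hn₁], by simp [hP, hn₂]⟩
  · rw [hA, Finset.card_biUnion fun i _ i' _ => hdisj i i']
    simp only [Finset.card_image_of_injective _ (add_left_injective _)]
    simp
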